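/- Let A be an enriched matrix. If A contains none of D_0, D_4, nor their dual matrices as subconfigurations, then for every two rows r1, r2 of A colored with distinct colors and both labeled L (or both labeled R), and every nonempty LR-row r of A, either r1 is contained in r or r2 is contained in r. -/

import Mathlib

/-- Labels for rows of an enriched matrix. -/
inductive RowLabel : Type
  | L | R | LR
deriving DecidableEq

/-- Colors for rows/blocks of an enriched matrix. -/
inductive RowColor : Type
  | red | blue
deriving DecidableEq

/-- An enriched matrix: a (0,1)-matrix whose rows may carry an optional label in
{L, R, LR} and an optional color in {red, blue}, where only L-rows, R-rows and
all-zero LR-rows may be colored, and all colored all-zero LR-rows have the same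
color. -/
structure EnrichedMatrix (m n : ℕ) : Type where
  entry : Fin m → Fin n → Bool
  label : Fin m → Option RowLabel
  color : Fin m → Option RowColor
  color_rows : ∀ i, (color i).isSome = true →
    label i = some RowLabel.L ∨ label i = some RowLabel.R ∨
      (label i = some RowLabel.LR ∧ ∀ j, entry i j = false)
  lr_color_unique : ∀ i k, label i = some RowLabel.LR → label k = some RowLabel.LR →
    (color i).isSome = true → (color k).isSome = true → color i = color k

namespace EnrichedMatrix

variable {m n : ℕ} (A : EnrichedMatrix m n)

/-- Two rows are disjoint: they share no 1-column. -/
def RowDisj (i k : Fin m) : Prop := ∀ j, ¬(A.entry i j = true ∧ A.entry k j = true)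

/-- Row `i` is contained in row `k`. -/
def RowLe (i k : Fin m) : Prop := ∀ j, A.entry i j = true → A.entry k j = true

/-- Two rows are nested: one is contained in the other. -/
def RowNested (i k : Fin m) : Prop := A.RowLe i k ∨ A.RowLe k i

/-- A row is nonempty: it has at least one 1. -/
def RowNonempty (i : Fin m) : Prop := ∃ j, A.entry i j = true

/-- Rows `i` and `k` are both colored, with the same color. -/
def SameColor (i k : Fin m) : Prop := ∃ c, A.color i = some c ∧ A.color k = some c

/-- Rows `i` and `k` are both colored, with distinct colors. -/
def DistinctColors (i k : Fin m) : Prop :=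
  ∃ c d, A.color i = some c ∧ A.color k = some d ∧ c ≠ d

end EnrichedMatrix

namespace EnrichedMatrix

/-- `A` contains `D_0` (for `ℓ = L`) or its dual (for `ℓ = R`) as a subconfiguration. -/
def ContainsD0 {m n : ℕ} (A : EnrichedMatrix m n) (ℓ : RowLabel) : Prop :=
  ∃ (i₁ i₂ : Fin m) (j₁ j₂ : Fin n), i₁ ≠ i₂ ∧ j₁ ≠ j₂ ∧
    A.label i₁ = some ℓ ∧ A.label i₂ = some ℓ ∧
    A.entry i₁ j₁ = true ∧ A.entry i₁ j₂ = false ∧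
    A.entry i₂ j₁ = false ∧ A.entry i₂ j₂ = true

/-- `A` contains `D_4` (for `ℓ = L`) or its dual (for `ℓ = R`) as a subconfiguration:
two rows labeled `ℓ`, colored with distinct colors, both with a 1 in a column where an
uncolored LR-row has a 0. -/
def ContainsD4 {m n : ℕ} (A : EnrichedMatrix m n) (ℓ : RowLabel) : Prop :=
  ∃ (i₁ i₂ i₃ : Fin m) (j : Fin n),
    A.label i₁ = some ℓ ∧ A.label i₂ = some ℓ ∧ A.DistinctColors i₁ i₂ ∧
    A.label i₃ = some RowLabel.LR ∧ A.color i₃ = none ∧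
    A.entry i₁ j = true ∧ A.entry i₂ j = true ∧ A.entry i₃ j = false

end EnrichedMatrix

namespace EnrichedMatrix

/-- A nonempty LR-row is uncolored. -/
theorem color_eq_none_of_label_eq_LR {m n : ℕ} (A : EnrichedMatrix m n) {r : Fin m}
    (hr : A.label r = some RowLabel.LR) (hne : A.RowNonempty r) : A.color r = none := by
  obtain ⟨j, hj⟩ := hne
  by_contra hc
  rcases A.color_rows r (Option.isSome_iff_ne_none.mpr hc) with h | h | ⟨-, h⟩
  · simp [hr] at h
  · simp [hr] at h
  · simp [h j] at hj

/-- Given two rows with the same label and distinct colors and an uncolored LR-row,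
one of the two is contained in the LR-row, provided neither `D_0` nor `D_4`
(or neither of their duals) occurs. -/
theorem rowLe_or_rowLe_of_not_containsD0_of_not_containsD4 {m n : ℕ}
    (A : EnrichedMatrix m n) {ℓ : RowLabel} (h₀ : ¬ A.ContainsD0 ℓ) (h₄ : ¬ A.ContainsD4 ℓ)
    {r₁ r₂ r : Fin m} (h₁ : A.label r₁ = some ℓ) (h₂ : A.label r₂ = some ℓ)
    (hd : A.DistinctColors r₁ r₂) (hr : A.label r = some RowLabel.LR)
    (hc : A.color r = none) : A.RowLe r₁ r ∨ A.RowLe r₂ r := by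
  by_contra! h
  simp only [RowLe, not_forall, Bool.not_eq_true] at h
  obtain ⟨⟨j₁, h₁j, hrj₁⟩, j₂, h₂j, hrj₂⟩ := h
  have h₂₁ : A.entry r₂ j₁ = false := by
    by_contra ht
    exact h₄ ⟨r₁, r₂, r, j₁, h₁, h₂, hd, hr, hc, h₁j, by simpa using ht, hrj₁⟩
  have h₁₂ : A.entry r₁ j₂ = false := by
    by_contra ht
    exact h₄ ⟨r₁, r₂, r, j₂, h₁, h₂, hd, hr, hc, by simpa using ht, h₂j, hrj₂⟩
  refine h₀ ⟨r₁, r₂, j₁, j₂, ?_, ?_, h₁, h₂, h₁j, h₁₂, h₂₁, h₂j⟩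
  · rintro rfl
    simp [h₁j] at h₂₁
  · rintro rfl
    simp [h₁j] at h₁₂

end EnrichedMatrix

/-- If `A` contains none of `D_0`, `D_4`, nor their duals as subconfigurations, then
for every two rows `r₁`, `r₂` colored with distinct colors and both labeled L (or both
labeled R), and every nonempty LR-row `r`, either `r₁` is contained in `r` or `r₂` is
contained in `r`. -/
theorem no_D0_D4_implies {m n : ℕ} (A : EnrichedMatrix m n)
    (h₀L : ¬ A.ContainsD0 RowLabel.L) (h₀R : ¬ A.ContainsD0 RowLabel.R)
    (h₄L : ¬ A.ContainsD4 RowLabel.L) (h₄R : ¬ A.ContainsD4 RowLabel.R) :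
    ∀ r₁ r₂ r : Fin m,
      ((A.label r₁ = some RowLabel.L ∧ A.label r₂ = some RowLabel.L) ∨
       (A.label r₁ = some RowLabel.R ∧ A.label r₂ = some RowLabel.R)) →
      A.DistinctColors r₁ r₂ →
      A.label r = some RowLabel.LR → A.RowNonempty r →
      A.RowLe r₁ r ∨ A.RowLe r₂ r := by
  rintro r₁ r₂ r (⟨h₁, h₂⟩ | ⟨h₁, h₂⟩) hd hr hne
  · exact A.rowLe_or_rowLe_of_not_containsD0_of_not_containsD4 h₀L h₄L h₁ h₂ hd hr
      (A.color_eq_none_of_label_eq_LR hr hne)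
  · exact A.rowLe_or_rowLe_of_not_containsD0_of_not_containsD4 h₀R h₄R h₁ h₂ hd hr
      (A.color_eq_none_of_label_eq_LR hr hne)
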